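/- Let u be real analytic on an open ball B centered at the origin of ℝ² with J[Δu, det D²u] ≡ 0 on B. Write u(x,y) = c₀ + ax + by + (λ/2)(x²+y²) + u₁(x,y), where c₀, a, b, λ ∈ ℝ and u₁ together with all its derivatives up to order two vanishes at the origin. Suppose that the lowest-degree non-zero homogeneous polynomial in the Taylor expansion of u₁ at the origin equals a₀(x²+y²)^{k+1} for some a₀ ≠ 0 and some integer k ≥ 1. Then u₁ is radial with respect to the origin on B, i.e. u₁(x,y) depends only on √(x²+y²). -/

import Mathlib

open Set Metric Topology Asymptotics MvPolynomial Matrix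

/-- Partial derivative with respect to the first variable. -/
noncomputable def pdx (f : ℝ × ℝ → ℝ) (p : ℝ × ℝ) : ℝ :=
  deriv (fun x => f (x, p.2)) p.1

/-- Partial derivative with respect to the second variable. -/
noncomputable def pdy (f : ℝ × ℝ → ℝ) (p : ℝ × ℝ) : ℝ :=
  deriv (fun y => f (p.1, y)) p.2

/-- The Laplacian `Δu = u_xx + u_yy`. -/
noncomputable def lap (f : ℝ × ℝ → ℝ) (p : ℝ × ℝ) : ℝ :=
  pdx (pdx f) p + pdy (pdy f) p

/-- The Hessian determinant `det D²u = u_xx u_yy - u_xy²`. -/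
noncomputable def hessDet (f : ℝ × ℝ → ℝ) (p : ℝ × ℝ) : ℝ :=
  pdx (pdx f) p * pdy (pdy f) p - (pdx (pdy f) p) ^ 2

/-- The Jacobian `J[f,g] = f_x g_y - f_y g_x`. -/
noncomputable def jacDet (f g : ℝ × ℝ → ℝ) (p : ℝ × ℝ) : ℝ :=
  pdx f p * pdy g p - pdy f p * pdx g p

section Vanishing

open Filter

variable {E F : Type*} [NormedAddCommGroup E] [NormedSpace ℝ E]
  [NormedAddCommGroup F] [NormedSpace ℝ F]

theorem tendsto_smul_nhdsGT_zero (y : E) :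
    Tendsto (fun t : ℝ => t • y) (𝓝[>] 0) (𝓝 0) :=
  ((continuous_id.smul continuous_const).tendsto' 0 0 (zero_smul ℝ y)).mono_left
    nhdsWithin_le_nhds

/-- The behaviour along rays of a function which is `o(‖y‖ ^ m)` at the origin. -/
theorem tendsto_ray_of_isLittleO {f : E → F} {m : ℕ} (ho : f =o[𝓝 0] fun y => ‖y‖ ^ m) (y : E) :
    Tendsto (fun t : ℝ => (t ^ m)⁻¹ • f (t • y)) (𝓝[>] 0) (𝓝 0) := by
  refine ((ho.comp_tendsto (tendsto_smul_nhdsGT_zero y)).trans_isBigO ?_).tendsto_inv_smul_nhds_zero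
  refine IsBigO.of_bound (‖y‖ ^ m) (Eventually.of_forall fun t => le_of_eq ?_)
  simp [norm_smul, mul_pow, mul_comm]

/-- A homogeneous function of degree `m` that is `o(‖y‖ ^ m)` at the origin vanishes. -/
theorem eq_zero_of_isLittleO_of_homogeneous {P : E → F} {m : ℕ}
    (hP : ∀ (t : ℝ) (y : E), 0 < t → P (t • y) = t ^ m • P y)
    (ho : P =o[𝓝 0] fun y => ‖y‖ ^ m) (y : E) : P y = 0 := by
  refine tendsto_nhds_unique (tendsto_const_nhds.congr' ?_) (tendsto_ray_of_isLittleO ho y)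
  filter_upwards [self_mem_nhdsWithin] with t ht
  have ht : 0 < t := ht
  rw [hP t y ht, inv_smul_smul₀ (by positivity)]

/-- If an analytic function is `o(‖y‖ ^ m)` at the origin, then the terms of degree at most `m`
of its power series vanish on the diagonal. -/
theorem HasFPowerSeriesAt.apply_diag_eq_zero_of_isLittleO {f : E → F}
    {p : FormalMultilinearSeries ℝ E F} (hp : HasFPowerSeriesAt f p 0) {m : ℕ}
    (ho : f =o[𝓝 0] fun y => ‖y‖ ^ m) :
    ∀ j ≤ m, ∀ y : E, p j (fun _ => y) = 0 := by
  intro j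
  induction j using Nat.strong_induction_on with
  | _ j ih =>
  intro hj
  have h1 := hp.isBigO_sub_partialSum_pow (j + 1)
  have h2 : ∀ y, p.partialSum (j + 1) y = p j fun _ => y := by
    intro y
    rw [FormalMultilinearSeries.partialSum, Finset.sum_range_succ, Finset.sum_eq_zero, zero_add]
    intro i hi
    rw [Finset.mem_range] at hi
    exact ih i hi (by omega) y
  simp only [h2, zero_add] at h1
  have h3 : (fun y : E => ‖y‖ ^ (j + 1)) =o[𝓝 0] fun y => ‖y‖ ^ j :=
    isLittleO_norm_pow_norm_pow (Nat.lt_succ_self j)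
  have h4 : f =o[𝓝 0] fun y => ‖y‖ ^ j := by
    rcases hj.eq_or_lt with rfl | hlt
    · exact ho
    · exact ho.trans (isLittleO_norm_pow_norm_pow hlt)
  have h5 := h4.sub (h1.trans_isLittleO h3)
  simp only [sub_sub_cancel] at h5
  refine eq_zero_of_isLittleO_of_homogeneous (m := j) (fun t y _ => ?_) h5
  have := (p j).map_smul_univ (fun _ => t) (fun _ => y)
  simpa using this

/-- The derivative of an analytic function which is `o(‖y‖ ^ (m + 1))` is `o(‖y‖ ^ m)`. -/
theorem AnalyticAt.fderiv_isLittleO [CompleteSpace F] {f : E → F} (hf : AnalyticAt ℝ f 0) {m : ℕ}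
    (ho : f =o[𝓝 0] fun y => ‖y‖ ^ (m + 1)) :
    fderiv ℝ f =o[𝓝 0] fun y => ‖y‖ ^ m := by
  obtain ⟨p, r, hp⟩ := hf
  have hz := HasFPowerSeriesAt.apply_diag_eq_zero_of_isLittleO ⟨r, hp⟩ ho
  let p' : FormalMultilinearSeries ℝ E F := fun n => if n ≤ m + 1 then 0 else p n
  have hp' : HasFPowerSeriesOnBall f p' 0 r := by
    refine ⟨hp.r_le.trans (FormalMultilinearSeries.radius_le_of_le fun n => ?_), hp.r_pos,
      fun {y} hy => ?_⟩
    · by_cases h : n ≤ m + 1 <;> simp [p', h]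
    · convert hp.hasSum hy using 2 with n
      by_cases h : n ≤ m + 1
      · simp [p', h, hz n h y]
      · simp [p', h]
  have hd : HasFPowerSeriesAt (fderiv ℝ f) p'.derivSeries 0 := ⟨r, hp'.fderiv⟩
  have h1 := hd.isBigO_sub_partialSum_pow (m + 1)
  have h2 : ∀ y, p'.derivSeries.partialSum (m + 1) y = 0 := by
    intro y
    refine Finset.sum_eq_zero fun n hn => ?_
    have hn : 1 + n ≤ m + 1 := by rw [Finset.mem_range] at hn; omega
    have : p' (1 + n) = 0 := if_pos hn
    simp [FormalMultilinearSeries.derivSeries, FormalMultilinearSeries.changeOriginSeries,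
      FormalMultilinearSeries.changeOriginSeriesTerm, this]
    exact Finset.sum_eq_zero fun _ _ => by
      rw [LinearIsometryEquiv.map_zero]; simp
  simp only [h2, zero_add, sub_zero] at h1
  exact h1.trans_isLittleO (isLittleO_norm_pow_norm_pow (Nat.lt_succ_self m))

/-- An analytic function which does not vanish identically near the origin has a leading
homogeneous term. -/
theorem AnalyticAt.exists_leading_term {f : E → F} (hf : AnalyticAt ℝ f 0)
    (hne : ¬ ∀ᶠ y in 𝓝 (0 : E), f y = 0) :
    ∃ (m : ℕ) (q : E [×m]→L[ℝ] F), (∃ y, q (fun _ => y) ≠ 0) ∧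
      (fun y => f y - q fun _ => y) =o[𝓝 0] fun y => ‖y‖ ^ m := by
  classical
  obtain ⟨p, hp⟩ := hf
  have hex : ∃ m, ∃ y, p m (fun _ => y) ≠ 0 := by
    by_contra! h
    refine hne ?_
    filter_upwards [hp.eventually_hasSum] with y hy
    simp only [h, zero_add] at hy
    exact hy.unique hasSum_zero
  refine ⟨Nat.find hex, p _, Nat.find_spec hex, ?_⟩
  have h1 := hp.isBigO_sub_partialSum_pow (Nat.find hex + 1)
  have h2 : ∀ y, p.partialSum (Nat.find hex + 1) y = p (Nat.find hex) fun _ => y := by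
    intro y
    rw [FormalMultilinearSeries.partialSum, Finset.sum_range_succ, Finset.sum_eq_zero, zero_add]
    intro i hi
    have := Nat.find_min hex (Finset.mem_range.mp hi)
    push Not at this
    exact this y
  simp only [h2, zero_add] at h1
  exact h1.trans_isLittleO (isLittleO_norm_pow_norm_pow (Nat.lt_succ_self _))

end Vanishing

/-- A periodic solution of `q'' = c q` with `c > 0` vanishes. -/
theorem eq_zero_of_periodic_of_hasDerivAt {q q' : ℝ → ℝ} {c T : ℝ} (hc : 0 < c) (hT : 0 < T)
    (hq : ∀ x, HasDerivAt q (q' x) x) (hq' : ∀ x, HasDerivAt q' (c * q x) x)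
    (hp : Function.Periodic q T) (hp' : Function.Periodic q' T) (x : ℝ) : q x = 0 := by
  have hw : ∀ x, HasDerivAt (fun y => q y * q' y) (q' x * q' x + q x * (c * q x)) x :=
    fun x => (hq x).mul (hq' x)
  have hmono : Monotone fun y => q y * q' y := by
    refine monotone_of_hasDerivAt_nonneg hw fun x => ?_
    have := mul_nonneg hc.le (mul_self_nonneg (q x))
    have := mul_self_nonneg (q' x)
    simp only [Pi.zero_apply]
    nlinarith
  have hper : Function.Periodic (fun y => q y * q' y) T := hp.mul hp'
  have hle : ∀ x y, q x * q' x ≤ q y * q' y := by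
    intro x y
    obtain ⟨n, hn⟩ := exists_nat_ge ((x - y) / T)
    rw [div_le_iff₀ hT] at hn
    have h1 := hmono (show x ≤ y + n * T by linarith)
    have h2 := hper.nat_mul n y
    simp only at h1 h2
    linarith
  have hconst : (fun y => q y * q' y) = fun _ => q x * q' x :=
    funext fun y => le_antisymm (hle _ _) (hle _ _)
  have h0 := hw x
  rw [hconst] at h0
  have h1 := h0.unique (hasDerivAt_const x _)
  have h2 := mul_self_nonneg (q' x)
  have h3 : c * (q x * q x) ≤ 0 := by nlinarith
  have h4 : q x * q x ≤ 0 := by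
    by_contra! h
    nlinarith [mul_pos hc h]
  exact mul_self_eq_zero.mp (le_antisymm h4 (mul_self_nonneg _))

section Partial

variable {f g : ℝ × ℝ → ℝ} {p : ℝ × ℝ}

theorem AnalyticAt.pdx_eq_fderiv (hf : AnalyticAt ℝ f p) : pdx f p = fderiv ℝ f p (1, 0) :=
  (hf.differentiableAt.hasFDerivAt.comp_hasDerivAt p.1
    ((hasDerivAt_id p.1).prodMk (hasDerivAt_const p.1 p.2))).deriv

theorem AnalyticAt.pdy_eq_fderiv (hf : AnalyticAt ℝ f p) : pdy f p = fderiv ℝ f p (0, 1) :=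
  (hf.differentiableAt.hasFDerivAt.comp_hasDerivAt p.2
    ((hasDerivAt_const p.2 p.1).prodMk (hasDerivAt_id p.2))).deriv

/-- Chain rule along a plane curve in terms of partial derivatives. -/
theorem AnalyticAt.hasDerivAt_comp_curve {α β : ℝ → ℝ} {α' β' t : ℝ}
    (hf : AnalyticAt ℝ f (α t, β t)) (hα : HasDerivAt α α' t) (hβ : HasDerivAt β β' t) :
    HasDerivAt (fun s => f (α s, β s))
      (pdx f (α t, β t) * α' + pdy f (α t, β t) * β') t := by
  refine (hf.differentiableAt.hasFDerivAt.comp_hasDerivAt t (hα.prodMk hβ)).congr_deriv ?_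
  have : (α', β') = α' • ((1 : ℝ), (0 : ℝ)) + β' • ((0 : ℝ), (1 : ℝ)) := by simp
  rw [this, map_add, map_smul, map_smul, hf.pdx_eq_fderiv, hf.pdy_eq_fderiv]
  simp [mul_comm]

theorem AnalyticAt.hasDerivAt_pdx (hf : AnalyticAt ℝ f p) :
    HasDerivAt (fun x => f (x, p.2)) (pdx f p) p.1 := by
  simpa using AnalyticAt.hasDerivAt_comp_curve (α := id) (β := fun _ => p.2) hf
    (hasDerivAt_id p.1) (hasDerivAt_const p.1 p.2)

theorem AnalyticAt.hasDerivAt_pdy (hf : AnalyticAt ℝ f p) :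
    HasDerivAt (fun y => f (p.1, y)) (pdy f p) p.2 := by
  simpa using AnalyticAt.hasDerivAt_comp_curve (α := fun _ => p.1) (β := id) hf
    (hasDerivAt_const p.2 p.1) (hasDerivAt_id p.2)

theorem AnalyticAt.partialX (hf : AnalyticAt ℝ f p) : AnalyticAt ℝ (pdx f) p := by
  refine (((ContinuousLinearMap.apply ℝ ℝ ((1 : ℝ), (0 : ℝ))).analyticAt _).comp
    hf.fderiv).congr ?_
  filter_upwards [hf.eventually_analyticAt] with q hq
  exact hq.pdx_eq_fderiv.symm

theorem AnalyticAt.partialY (hf : AnalyticAt ℝ f p) : AnalyticAt ℝ (pdy f) p := by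
  refine (((ContinuousLinearMap.apply ℝ ℝ ((0 : ℝ), (1 : ℝ))).analyticAt _).comp
    hf.fderiv).congr ?_
  filter_upwards [hf.eventually_analyticAt] with q hq
  exact hq.pdy_eq_fderiv.symm

theorem pdx_congr (h : f =ᶠ[𝓝 p] g) : pdx f p = pdx g p := by
  refine Filter.EventuallyEq.deriv_eq ?_
  have : Filter.Tendsto (fun x : ℝ => (x, p.2)) (𝓝 p.1) (𝓝 p) :=
    (Continuous.prodMk continuous_id continuous_const).tendsto' _ _ rfl
  exact this.eventually h

theorem pdy_congr (h : f =ᶠ[𝓝 p] g) : pdy f p = pdy g p := by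
  refine Filter.EventuallyEq.deriv_eq ?_
  have : Filter.Tendsto (fun y : ℝ => (p.1, y)) (𝓝 p.2) (𝓝 p) :=
    (Continuous.prodMk continuous_const continuous_id).tendsto' _ _ rfl
  exact this.eventually h

/-- Partial derivatives of an analytic function commute. -/
theorem AnalyticAt.pdy_pdx (hf : AnalyticAt ℝ f p) :
    pdy (pdx f) p = pdx (pdy f) p := by
  have hx : pdx f =ᶠ[𝓝 p] fun q => fderiv ℝ f q (1, 0) :=
    hf.eventually_analyticAt.mono fun q hq => hq.pdx_eq_fderiv
  have hy : pdy f =ᶠ[𝓝 p] fun q => fderiv ℝ f q (0, 1) :=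
    hf.eventually_analyticAt.mono fun q hq => hq.pdy_eq_fderiv
  have hd : DifferentiableAt ℝ (fderiv ℝ f) p := hf.fderiv.differentiableAt
  have hsymm : IsSymmSndFDerivAt ℝ f p :=
    (hf.contDiffAt (n := ⊤)).isSymmSndFDerivAt (by simp)
  rw [hf.partialX.pdy_eq_fderiv, hf.partialY.pdx_eq_fderiv, hx.fderiv_eq, hy.fderiv_eq,
    fderiv_clm_apply hd (differentiableAt_const _), fderiv_clm_apply hd (differentiableAt_const _)]
  simpa using hsymm (0, 1) (1, 0)

theorem AnalyticAt.laplacian (hf : AnalyticAt ℝ f p) : AnalyticAt ℝ (lap f) p :=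
  hf.partialX.partialX.add hf.partialY.partialY

theorem AnalyticAt.hessianDet (hf : AnalyticAt ℝ f p) : AnalyticAt ℝ (hessDet f) p :=
  (hf.partialX.partialX.mul hf.partialY.partialY).sub (hf.partialY.partialX.pow 2)

theorem AnalyticAt.pdx_lap (hf : AnalyticAt ℝ f p) :
    pdx (lap f) p =
      pdx (pdx (pdx f)) p + pdx (pdy (pdy f)) p :=
  (hf.partialX.partialX.hasDerivAt_pdx.add hf.partialY.partialY.hasDerivAt_pdx).deriv

theorem AnalyticAt.pdy_lap (hf : AnalyticAt ℝ f p) :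
    pdy (lap f) p =
      pdy (pdx (pdx f)) p + pdy (pdy (pdy f)) p :=
  (hf.partialX.partialX.hasDerivAt_pdy.add hf.partialY.partialY.hasDerivAt_pdy).deriv

theorem AnalyticAt.pdx_hessDet (hf : AnalyticAt ℝ f p) :
    pdx (hessDet f) p =
      pdx (pdx (pdx f)) p * pdy (pdy f) p
        + pdx (pdx f) p * pdx (pdy (pdy f)) p
        - 2 * pdx (pdy f) p * pdx (pdx (pdy f)) p := by
  refine (((hf.partialX.partialX.hasDerivAt_pdx.mul hf.partialY.partialY.hasDerivAt_pdx).sub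
    (hf.partialY.partialX.hasDerivAt_pdx.pow 2)).deriv).trans ?_
  simp

theorem AnalyticAt.pdy_hessDet (hf : AnalyticAt ℝ f p) :
    pdy (hessDet f) p =
      pdy (pdx (pdx f)) p * pdy (pdy f) p
        + pdx (pdx f) p * pdy (pdy (pdy f)) p
        - 2 * pdx (pdy f) p * pdy (pdx (pdy f)) p := by
  refine (((hf.partialX.partialX.hasDerivAt_pdy.mul hf.partialY.partialY.hasDerivAt_pdy).sub
    (hf.partialY.partialX.hasDerivAt_pdy.pow 2)).deriv).trans ?_
  simp

/-- The angular derivative `x f_y - y f_x`. -/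
noncomputable def angDeriv (f : ℝ × ℝ → ℝ) (p : ℝ × ℝ) : ℝ :=
  p.1 * pdy f p - p.2 * pdx f p

theorem AnalyticAt.angular (hf : AnalyticAt ℝ f p) : AnalyticAt ℝ (angDeriv f) p :=
  (analyticAt_fst.mul hf.partialY).sub (analyticAt_snd.mul hf.partialX)

theorem AnalyticAt.pdx_angDeriv (hf : AnalyticAt ℝ f p) :
    pdx (angDeriv f) p = angDeriv (pdx f) p + pdy f p := by
  have h : HasDerivAt (fun x => angDeriv f (x, p.2)) _ p.1 :=
    ((hasDerivAt_id p.1).mul hf.partialY.hasDerivAt_pdx).sub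
    (hf.partialX.hasDerivAt_pdx.const_mul p.2)
  refine h.deriv.trans ?_
  rw [angDeriv, hf.pdy_pdx]
  simp
  ring

theorem AnalyticAt.pdy_angDeriv (hf : AnalyticAt ℝ f p) :
    pdy (angDeriv f) p = angDeriv (pdy f) p - pdx f p := by
  have h : HasDerivAt (fun y => angDeriv f (p.1, y)) _ p.2 :=
    (hf.partialY.hasDerivAt_pdy.const_mul p.1).sub
    ((hasDerivAt_id p.2).mul hf.partialX.hasDerivAt_pdy)
  refine h.deriv.trans ?_
  rw [angDeriv, hf.pdy_pdx]
  simp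
  ring

theorem AnalyticAt.pdx_pdx_angDeriv (hf : AnalyticAt ℝ f p) :
    pdx (pdx (angDeriv f)) p =
      angDeriv (pdx (pdx f)) p + 2 * pdx (pdy f) p := by
  rw [pdx_congr (hf.eventually_analyticAt.mono fun q hq => hq.pdx_angDeriv)]
  refine (hf.partialX.angular.hasDerivAt_pdx.add hf.partialY.hasDerivAt_pdx).deriv.trans ?_
  rw [hf.partialX.pdx_angDeriv, hf.pdy_pdx]
  ring

theorem AnalyticAt.pdx_pdy_angDeriv (hf : AnalyticAt ℝ f p) :
    pdx (pdy (angDeriv f)) p =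
      angDeriv (pdx (pdy f)) p
        + pdy (pdy f) p - pdx (pdx f) p := by
  rw [pdx_congr (hf.eventually_analyticAt.mono fun q hq => hq.pdy_angDeriv)]
  refine (hf.partialY.angular.hasDerivAt_pdx.sub hf.partialX.hasDerivAt_pdx).deriv.trans ?_
  rw [hf.partialY.pdx_angDeriv]

theorem AnalyticAt.pdy_pdy_angDeriv (hf : AnalyticAt ℝ f p) :
    pdy (pdy (angDeriv f)) p =
      angDeriv (pdy (pdy f)) p - 2 * pdx (pdy f) p := by
  rw [pdy_congr (hf.eventually_analyticAt.mono fun q hq => hq.pdy_angDeriv)]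
  refine (hf.partialY.angular.hasDerivAt_pdy.sub hf.partialX.hasDerivAt_pdy).deriv.trans ?_
  rw [hf.partialY.pdy_angDeriv, hf.pdy_pdx]
  ring

/-- The Euler operator `x f_x + y f_y`. -/
noncomputable def eulerOp (f : ℝ × ℝ → ℝ) (p : ℝ × ℝ) : ℝ :=
  p.1 * pdx f p + p.2 * pdy f p

/-- The mixed term `f_yy g_xx + f_xx g_yy - 2 f_xy g_xy`, which is the linearization at `f` of the
Hessian determinant in the direction `g`. -/
noncomputable def hessMixed (f g : ℝ × ℝ → ℝ) (p : ℝ × ℝ) : ℝ :=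
  pdy (pdy f) p * pdx (pdx g) p + pdx (pdx f) p * pdy (pdy g) p
    - 2 * pdx (pdy f) p * pdx (pdy g) p

/-- The Jacobian of `Δf` and `det D²f` as a linear expression in the angular derivative of `f`. -/
theorem AnalyticAt.jacDet_lap_hessDet (hf : AnalyticAt ℝ f p) :
    (p.1 ^ 2 + p.2 ^ 2) * jacDet (lap f) (hessDet f) p =
      eulerOp (lap f) p * hessMixed f (angDeriv f) p
        - eulerOp (hessDet f) p * lap (angDeriv f) p := by
  have h1 : lap (angDeriv f) p = angDeriv (lap f) p := by
    rw [lap, hf.pdx_pdx_angDeriv, hf.pdy_pdy_angDeriv, angDeriv, angDeriv,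
      angDeriv, hf.pdx_lap, hf.pdy_lap]
    ring
  have h2 : hessMixed f (angDeriv f) p = angDeriv (hessDet f) p := by
    rw [hessMixed, hf.pdx_pdx_angDeriv, hf.pdy_pdy_angDeriv, hf.pdx_pdy_angDeriv]
    simp only [angDeriv]
    rw [hf.pdx_hessDet, hf.pdy_hessDet]
    ring
  rw [h1, h2, angDeriv, angDeriv, eulerOp, eulerOp, jacDet]
  ring

end Partial

section Leading

open Filter

/-- `P` is homogeneous of degree `m` and equals the degree `m` part of `f`, all the terms of lower
degree being zero. -/
structure IsLeading (m : ℕ) (f P : ℝ × ℝ → ℝ) : Prop where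
  analyticAt : AnalyticAt ℝ f 0
  analytic : ∀ p, AnalyticAt ℝ P p
  homogeneous : ∀ (t : ℝ) (p : ℝ × ℝ), 0 < t → P (t • p) = t ^ m • P p
  isLittleO : (fun p => f p - P p) =o[𝓝 0] fun p => ‖p‖ ^ m

namespace IsLeading

variable {m : ℕ} {f g P Q : ℝ × ℝ → ℝ}

theorem tendsto_ray (h : IsLeading m f P) (p : ℝ × ℝ) :
    Tendsto (fun t : ℝ => (t ^ m)⁻¹ * f (t • p)) (𝓝[>] 0) (𝓝 (P p)) := by
  have h1 := (tendsto_ray_of_isLittleO h.isLittleO p).add_const (P p)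
  rw [zero_add] at h1
  refine h1.congr' ?_
  filter_upwards [self_mem_nhdsWithin] with t ht
  have ht : 0 < t := ht
  have htm : t ^ m ≠ 0 := by positivity
  rw [h.homogeneous t p ht, smul_eq_mul, smul_eq_mul]
  field_simp
  ring

theorem add (hf : IsLeading m f P) (hg : IsLeading m g Q) :
    IsLeading m (fun p => f p + g p) (fun p => P p + Q p) where
  analyticAt := hf.analyticAt.add hg.analyticAt
  analytic p := (hf.analytic p).add (hg.analytic p)
  homogeneous t p ht := by rw [hf.homogeneous t p ht, hg.homogeneous t p ht, smul_add]
  isLittleO := (hf.isLittleO.add hg.isLittleO).congr_left fun p => by ring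

theorem partialX (h : IsLeading (m + 1) f P) : IsLeading m (pdx f) (pdx P) where
  analyticAt := h.analyticAt.partialX
  analytic p := (h.analytic p).partialX
  homogeneous t p ht := by
    have h1 : (fun x => P (t * x, t * p.2)) = fun x => t ^ (m + 1) * P (x, p.2) :=
      funext fun x => h.homogeneous t (x, p.2) ht
    have h2 := deriv_comp_mul_left t (fun x => P (x, t * p.2)) p.1
    rw [h1, deriv_const_mul_field, smul_eq_mul] at h2
    refine mul_left_cancel₀ ht.ne' (h2.symm.trans ?_)
    rw [smul_eq_mul, pdx]
    ring
  isLittleO := by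
    have h1 := (h.analyticAt.sub (h.analytic 0)).fderiv_isLittleO h.isLittleO
    refine IsLittleO.congr' ((ContinuousLinearMap.apply ℝ ℝ ((1 : ℝ), (0 : ℝ))).isBigO_comp _ _
      |>.trans_isLittleO h1) ?_ EventuallyEq.rfl
    filter_upwards [h.analyticAt.eventually_analyticAt] with p hp
    have hs := hp.sub (h.analytic p)
    exact hs.pdx_eq_fderiv.symm.trans
      (hp.hasDerivAt_pdx.sub (h.analytic p).hasDerivAt_pdx).deriv

theorem partialY (h : IsLeading (m + 1) f P) : IsLeading m (pdy f) (pdy P) where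
  analyticAt := h.analyticAt.partialY
  analytic p := (h.analytic p).partialY
  homogeneous t p ht := by
    have h1 : (fun y => P (t * p.1, t * y)) = fun y => t ^ (m + 1) * P (p.1, y) :=
      funext fun y => h.homogeneous t (p.1, y) ht
    have h2 := deriv_comp_mul_left t (fun y => P (t * p.1, y)) p.2
    rw [h1, deriv_const_mul_field, smul_eq_mul] at h2
    refine mul_left_cancel₀ ht.ne' (h2.symm.trans ?_)
    rw [smul_eq_mul, pdy]
    ring
  isLittleO := by
    have h1 := (h.analyticAt.sub (h.analytic 0)).fderiv_isLittleO h.isLittleO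
    refine IsLittleO.congr' ((ContinuousLinearMap.apply ℝ ℝ ((0 : ℝ), (1 : ℝ))).isBigO_comp _ _
      |>.trans_isLittleO h1) ?_ EventuallyEq.rfl
    filter_upwards [h.analyticAt.eventually_analyticAt] with p hp
    have hs := hp.sub (h.analytic p)
    exact hs.pdy_eq_fderiv.symm.trans
      (hp.hasDerivAt_pdy.sub (h.analytic p).hasDerivAt_pdy).deriv

theorem laplacian (h : IsLeading (m + 2) f P) : IsLeading m (lap f) (lap P) :=
  h.partialX.partialX.add h.partialY.partialY

/-- Euler's identity. -/
theorem eulerOp_eq (h : IsLeading m f P) (p : ℝ × ℝ) : eulerOp P p = m * P p := by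
  have h1 := AnalyticAt.hasDerivAt_comp_curve (f := P) (α := fun t => t * p.1)
    (β := fun t => t * p.2) (t := 1) (h.analytic _)
    ((hasDerivAt_id (1 : ℝ)).mul_const p.1) ((hasDerivAt_id (1 : ℝ)).mul_const p.2)
  have h2 : HasDerivAt (fun t : ℝ => t ^ m * P p) (m * (1 : ℝ) ^ (m - 1) * P p) 1 :=
    (hasDerivAt_pow m (1 : ℝ)).mul_const (P p)
  have h3 : (fun t : ℝ => P (t * p.1, t * p.2)) =ᶠ[𝓝 1] fun t => t ^ m * P p := by
    filter_upwards [lt_mem_nhds (zero_lt_one' ℝ)] with t ht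
    exact h.homogeneous t p ht
  have h4 := h1.unique (h2.congr_of_eventuallyEq h3)
  simp only [one_mul, one_pow, mul_one] at h4
  rw [← h4, eulerOp]
  ring

theorem tendsto_ray_pdx_hessDet (h : IsLeading (m + 3) f P) (p : ℝ × ℝ) :
    Tendsto (fun t : ℝ => (t ^ m)⁻¹ * (t ^ (m + 1))⁻¹ * pdx (hessDet f) (t • p)) (𝓝[>] 0)
      (𝓝 (pdx (hessDet P) p)) := by
  have hxx := h.partialX.partialX
  have hxy := h.partialY.partialX
  have hyy := h.partialY.partialY
  rw [(h.analytic p).pdx_hessDet]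
  refine ((((hxx.partialX.tendsto_ray p).mul (hyy.tendsto_ray p)).add
    ((hxx.tendsto_ray p).mul (hyy.partialX.tendsto_ray p))).sub
    (((hxy.tendsto_ray p).const_mul 2).mul (hxy.partialX.tendsto_ray p))).congr' ?_
  filter_upwards [(tendsto_smul_nhdsGT_zero p).eventually h.analyticAt.eventually_analyticAt]
    with t ht
  rw [ht.pdx_hessDet]
  ring

theorem tendsto_ray_pdy_hessDet (h : IsLeading (m + 3) f P) (p : ℝ × ℝ) :
    Tendsto (fun t : ℝ => (t ^ m)⁻¹ * (t ^ (m + 1))⁻¹ * pdy (hessDet f) (t • p)) (𝓝[>] 0)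
      (𝓝 (pdy (hessDet P) p)) := by
  have hxx := h.partialX.partialX
  have hxy := h.partialY.partialX
  have hyy := h.partialY.partialY
  rw [(h.analytic p).pdy_hessDet]
  refine ((((hxx.partialY.tendsto_ray p).mul (hyy.tendsto_ray p)).add
    ((hxx.tendsto_ray p).mul (hyy.partialY.tendsto_ray p))).sub
    (((hxy.tendsto_ray p).const_mul 2).mul (hxy.partialY.tendsto_ray p))).congr' ?_
  filter_upwards [(tendsto_smul_nhdsGT_zero p).eventually h.analyticAt.eventually_analyticAt]
    with t ht
  rw [ht.pdy_hessDet]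
  ring

/-- The equation satisfied by an angular derivative passes to leading terms. -/
theorem eulerOp_mul_hessMixed {n : ℕ} (hf : IsLeading (m + 3) f P) (hg : IsLeading (n + 2) g Q)
    (heq : ∀ᶠ p in 𝓝 0,
      eulerOp (lap f) p * hessMixed f g p - eulerOp (hessDet f) p * lap g p = 0) (p : ℝ × ℝ) :
    eulerOp (lap P) p * hessMixed P Q p - eulerOp (hessDet P) p * lap Q p = 0 := by
  have hL : IsLeading (m + 1) (lap f) (lap P) := hf.laplacian
  have hmixed := ((hf.partialY.partialY.tendsto_ray p).mul (hg.partialX.partialX.tendsto_ray p)).add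
    ((hf.partialX.partialX.tendsto_ray p).mul (hg.partialY.partialY.tendsto_ray p)) |>.sub
    (((hf.partialY.partialX.tendsto_ray p).const_mul 2).mul
      (hg.partialY.partialX.tendsto_ray p))
  have hA := ((hL.partialX.tendsto_ray p).const_mul p.1).add
    ((hL.partialY.tendsto_ray p).const_mul p.2)
  have hB := ((hf.tendsto_ray_pdx_hessDet p).const_mul p.1).add
    ((hf.tendsto_ray_pdy_hessDet p).const_mul p.2)
  have hlim := (hA.mul hmixed).sub (hB.mul (hg.laplacian.tendsto_ray p))
  refine tendsto_nhds_unique hlim (tendsto_const_nhds.congr' ?_)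
  filter_upwards [(tendsto_smul_nhdsGT_zero p).eventually heq, self_mem_nhdsWithin] with t ht ht0
  have ht0 : 0 < t := ht0
  simp only [eulerOp, hessMixed, Prod.smul_fst, Prod.smul_snd, smul_eq_mul] at ht
  have hc : t * t ^ m * t ^ (m + 1) * t ^ n ≠ 0 := by positivity
  refine mul_left_cancel₀ hc (Eq.trans ?_ (ht.symm.trans ?_))
  · rw [mul_zero]
  · field_simp

end IsLeading

/-- An angular derivative vanishes to higher order than a radial leading term. -/
theorem IsLeading.angDeriv_isLittleO {m : ℕ} {f P : ℝ × ℝ → ℝ} (h : IsLeading (m + 1) f P)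
    (hP : ∀ p, angDeriv P p = 0) : angDeriv f =o[𝓝 0] fun p => ‖p‖ ^ (m + 1) := by
  have hx : (fun p : ℝ × ℝ => p.1) =O[𝓝 0] fun p => ‖p‖ :=
    IsBigO.of_bound 1 (Eventually.of_forall fun p => by simpa using norm_fst_le p)
  have hy : (fun p : ℝ × ℝ => p.2) =O[𝓝 0] fun p => ‖p‖ :=
    IsBigO.of_bound 1 (Eventually.of_forall fun p => by simpa using norm_snd_le p)
  refine ((hx.mul_isLittleO h.partialY.isLittleO).sub
    (hy.mul_isLittleO h.partialX.isLittleO)).congr (fun p => ?_) fun p => by ring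
  have := hP p
  simp only [angDeriv] at this ⊢
  linear_combination -this

theorem AnalyticAt.exists_isLeading {f : ℝ × ℝ → ℝ} (hf : AnalyticAt ℝ f 0)
    (hne : ¬ ∀ᶠ p in 𝓝 0, f p = 0) :
    ∃ (m : ℕ) (Q : ℝ × ℝ → ℝ), IsLeading m f Q ∧ ∃ p, Q p ≠ 0 := by
  obtain ⟨m, q, hq, ho⟩ := hf.exists_leading_term hne
  refine ⟨m, fun p => q fun _ => p, ⟨hf, fun p => ?_, fun t p _ => ?_, ho⟩, hq⟩
  · exact q.analyticAt.comp (f := fun p : ℝ × ℝ => fun _ : Fin m => p)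
      (analyticAt_pi_iff.2 fun _ => analyticAt_id)
  · simpa using q.map_smul_univ (fun _ => t) fun _ => p

/-- The order of vanishing exceeds `n` for functions that are `o(‖p‖ ^ n)`. -/
theorem IsLeading.lt_of_isLittleO {m n : ℕ} {f Q : ℝ × ℝ → ℝ} (h : IsLeading m f Q)
    (hne : ∃ p, Q p ≠ 0) (ho : f =o[𝓝 0] fun p => ‖p‖ ^ n) : n < m := by
  by_contra! hmn
  obtain ⟨p, hp⟩ := hne
  have h1 : f =o[𝓝 0] fun p => ‖p‖ ^ m := by
    rcases hmn.eq_or_lt with rfl | hlt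
    · exact ho
    · exact ho.trans (isLittleO_norm_pow_norm_pow hlt)
  refine hp (eq_zero_of_isLittleO_of_homogeneous h.homogeneous ?_ p)
  exact (h1.sub h.isLittleO).congr_left fun p => by ring

end Leading

section RadialPower

/-- The radial monomial `c (x² + y²)^k`. -/
noncomputable def radialPow (c : ℝ) (k : ℕ) (p : ℝ × ℝ) : ℝ :=
  c * (p.1 ^ 2 + p.2 ^ 2) ^ k

theorem hasDerivAt_sq_add_pow_fst (x y : ℝ) (k : ℕ) :
    HasDerivAt (fun x : ℝ => (x ^ 2 + y ^ 2) ^ (k + 1))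
      (2 * (k + 1) * x * (x ^ 2 + y ^ 2) ^ k) x := by
  refine ((((hasDerivAt_pow 2 x).add_const (y ^ 2))).pow (k + 1)).congr_deriv ?_
  push_cast
  simp
  ring

theorem hasDerivAt_sq_add_pow_snd (x y : ℝ) (k : ℕ) :
    HasDerivAt (fun y : ℝ => (x ^ 2 + y ^ 2) ^ (k + 1))
      (2 * (k + 1) * y * (x ^ 2 + y ^ 2) ^ k) y := by
  simpa only [add_comm] using hasDerivAt_sq_add_pow_fst y x k

theorem analyticAt_radialPow (c : ℝ) (k : ℕ) (p : ℝ × ℝ) : AnalyticAt ℝ (radialPow c k) p :=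
  analyticAt_const.mul (((analyticAt_fst.pow 2).add (analyticAt_snd.pow 2)).pow k)

theorem radialPow_smul (c : ℝ) (k : ℕ) (t : ℝ) (p : ℝ × ℝ) :
    radialPow c k (t • p) = t ^ (2 * k) • radialPow c k p := by
  simp only [radialPow, Prod.smul_fst, Prod.smul_snd, smul_eq_mul, mul_pow, ← mul_add, pow_mul]
  ring

theorem pdx_radialPow (c : ℝ) (k : ℕ) :
    pdx (radialPow c (k + 1)) = fun p => 2 * c * (k + 1) * (p.1 * (p.1 ^ 2 + p.2 ^ 2) ^ k) := by
  funext p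
  refine ((hasDerivAt_sq_add_pow_fst p.1 p.2 k).const_mul c).deriv.trans ?_
  ring

theorem pdy_radialPow (c : ℝ) (k : ℕ) :
    pdy (radialPow c (k + 1)) = fun p => 2 * c * (k + 1) * (p.2 * (p.1 ^ 2 + p.2 ^ 2) ^ k) := by
  funext p
  refine ((hasDerivAt_sq_add_pow_snd p.1 p.2 k).const_mul c).deriv.trans ?_
  ring

theorem angDeriv_radialPow (c : ℝ) (k : ℕ) (p : ℝ × ℝ) :
    angDeriv (radialPow c (k + 1)) p = 0 := by
  rw [angDeriv, pdx_radialPow, pdy_radialPow]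
  ring

theorem eulerOp_radialPow (c : ℝ) (k : ℕ) (p : ℝ × ℝ) :
    eulerOp (radialPow c (k + 1)) p = 2 * (k + 1) * radialPow c (k + 1) p := by
  rw [eulerOp, pdx_radialPow, pdy_radialPow, radialPow]
  ring

theorem pdx_pdx_radialPow (c : ℝ) (k : ℕ) (p : ℝ × ℝ) :
    pdx (pdx (radialPow c (k + 2))) p =
      2 * c * (k + 2) * (p.1 ^ 2 + p.2 ^ 2) ^ k
        * (p.1 ^ 2 + p.2 ^ 2 + 2 * (k + 1) * p.1 ^ 2) := by
  rw [pdx_radialPow]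
  refine (((hasDerivAt_id p.1).mul (hasDerivAt_sq_add_pow_fst p.1 p.2 k)).const_mul
    _).deriv.trans ?_
  push_cast
  simp
  ring

theorem pdy_pdy_radialPow (c : ℝ) (k : ℕ) (p : ℝ × ℝ) :
    pdy (pdy (radialPow c (k + 2))) p =
      2 * c * (k + 2) * (p.1 ^ 2 + p.2 ^ 2) ^ k
        * (p.1 ^ 2 + p.2 ^ 2 + 2 * (k + 1) * p.2 ^ 2) := by
  rw [pdy_radialPow]
  refine (((hasDerivAt_id p.2).mul (hasDerivAt_sq_add_pow_snd p.1 p.2 k)).const_mul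
    _).deriv.trans ?_
  push_cast
  simp
  ring

theorem pdx_pdy_radialPow (c : ℝ) (k : ℕ) (p : ℝ × ℝ) :
    pdx (pdy (radialPow c (k + 2))) p =
      2 * c * (k + 2) * (p.1 ^ 2 + p.2 ^ 2) ^ k * (2 * (k + 1) * p.1 * p.2) := by
  rw [pdy_radialPow]
  refine (((hasDerivAt_sq_add_pow_fst p.1 p.2 k).const_mul p.2).const_mul
    _).deriv.trans ?_
  push_cast
  ring

theorem lap_radialPow (c : ℝ) (k : ℕ) :
    lap (radialPow c (k + 2)) = radialPow (4 * c * (k + 2) ^ 2) (k + 1) := by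
  funext p
  rw [lap, pdx_pdx_radialPow, pdy_pdy_radialPow, radialPow]
  ring

theorem hessDet_radialPow (c : ℝ) (k : ℕ) :
    hessDet (radialPow c (k + 2)) =
      radialPow (4 * c ^ 2 * (k + 2) ^ 2 * (2 * k + 3)) (2 * k + 1 + 1) := by
  funext p
  rw [hessDet, pdx_pdx_radialPow, pdy_pdy_radialPow, pdx_pdy_radialPow, radialPow]
  ring

end RadialPower

/-- Polar coordinates. -/
theorem exists_sqrt_smul_cos_sin (p : ℝ × ℝ) :
    ∃ θ : ℝ, p = √(p.1 ^ 2 + p.2 ^ 2) • (Real.cos θ, Real.sin θ) := by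
  have hn : ‖(⟨p.1, p.2⟩ : ℂ)‖ = √(p.1 ^ 2 + p.2 ^ 2) := by
    rw [Complex.norm_eq_sqrt_sq_add_sq]
  refine ⟨Complex.arg ⟨p.1, p.2⟩, Prod.ext ?_ ?_⟩
  · simpa [hn] using (Complex.norm_mul_cos_arg ⟨p.1, p.2⟩).symm
  · simpa [hn] using (Complex.norm_mul_sin_arg ⟨p.1, p.2⟩).symm

/-- The linearized equation at a radial monomial has no nonzero homogeneous solution of higher
degree. -/
theorem IsLeading.eq_zero_of_radialPow {c : ℝ} (hc : c ≠ 0) {k n : ℕ} {f Q : ℝ × ℝ → ℝ}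
    (h : IsLeading (n + 2) f Q) (hkn : 2 * k + 4 < n + 2)
    (heq : ∀ p, eulerOp (lap (radialPow c (k + 2))) p * hessMixed (radialPow c (k + 2)) Q p
      - eulerOp (hessDet (radialPow c (k + 2))) p * lap Q p = 0) (p : ℝ × ℝ) : Q p = 0 := by
  have hkn' : (2 * k + 4 : ℝ) < n + 2 := by exact_mod_cast hkn
  have hk0 : (0 : ℝ) ≤ k := Nat.cast_nonneg k
  have hn0 : (0 : ℝ) ≤ n := Nat.cast_nonneg n
  -- the tangential second derivative is a multiple of `Q` on the unit circle
  have htan : ∀ p : ℝ × ℝ, p.1 ^ 2 + p.2 ^ 2 = 1 →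
      (2 * k + 3) * (p.2 ^ 2 * pdx (pdx Q) p - 2 * p.1 * p.2 * pdx (pdy Q) p
        + p.1 ^ 2 * pdy (pdy Q) p) = (n + 2) * (n + 1) * Q p := by
    intro p hp
    have e0 := h.eulerOp_eq p
    have e1 := h.partialX.eulerOp_eq p
    have e2 := h.partialY.eulerOp_eq p
    have e3 := heq p
    rw [lap_radialPow, hessDet_radialPow, eulerOp_radialPow, eulerOp_radialPow, hessMixed,
      pdx_pdx_radialPow, pdy_pdy_radialPow, pdx_pdy_radialPow, radialPow, radialPow, lap] at e3
    rw [eulerOp] at e0 e1 e2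
    rw [(h.analytic p).pdy_pdx] at e1
    simp only [hp, one_pow, mul_one] at e3
    push_cast at e0 e1 e2 e3
    have hrad : p.1 ^ 2 * pdx (pdx Q) p + 2 * p.1 * p.2 * pdx (pdy Q) p
        + p.2 ^ 2 * pdy (pdy Q) p = (n + 2) * (n + 1) * Q p := by
      linear_combination p.1 * e1 + p.2 * e2 + (n + 1) * e0
    have hne : 16 * c ^ 2 * ((k : ℝ) + 2) ^ 2 * (k + 1) ^ 2 ≠ 0 := by positivity
    rw [← hrad]
    refine mul_left_cancel₀ hne ?_
    linear_combination e3 - 16 * c ^ 2 * ((k : ℝ) + 2) ^ 2 * (k + 1) ^ 2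
      * (pdx (pdx Q) p + pdy (pdy Q) p) * hp
  have hcirc : ∀ θ : ℝ, Q (Real.cos θ, Real.sin θ) = 0 := by
    let q' : ℝ → ℝ := fun θ => pdx Q (Real.cos θ, Real.sin θ) * -Real.sin θ
      + pdy Q (Real.cos θ, Real.sin θ) * Real.cos θ
    refine eq_zero_of_periodic_of_hasDerivAt (q' := q')
      (c := (n + 2) * (n + 1) / (2 * k + 3) - (n + 2)) (T := 2 * Real.pi) ?_ Real.two_pi_pos
      (fun θ => (h.analytic _).hasDerivAt_comp_curve (Real.hasDerivAt_cos θ)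
        (Real.hasDerivAt_sin θ)) (fun θ => ?_) (fun θ => by simp) (fun θ => by simp [q'])
    · rw [sub_pos, lt_div_iff₀ (by positivity)]
      nlinarith
    · have hcos := Real.hasDerivAt_cos θ
      have hsin := Real.hasDerivAt_sin θ
      refine ((((h.analytic _).partialX.hasDerivAt_comp_curve hcos hsin).mul hsin.neg).add
        (((h.analytic _).partialY.hasDerivAt_comp_curve hcos hsin).mul hcos)).congr_deriv ?_
      have e0 := h.eulerOp_eq (Real.cos θ, Real.sin θ)
      have e1 := htan (Real.cos θ, Real.sin θ) (Real.cos_sq_add_sin_sq θ)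
      rw [eulerOp] at e0
      rw [(h.analytic _).pdy_pdx]
      push_cast at e0
      simp only [Pi.neg_apply] at e0 e1 ⊢
      have hk3 : (2 * k + 3 : ℝ) ≠ 0 := by positivity
      field_simp
      linear_combination e1 - (2 * k + 3) * e0
  by_cases hp : p = 0
  · have := h.homogeneous 2 0 two_pos
    rw [smul_zero, smul_eq_mul, pow_succ] at this
    have h2 : (1 : ℝ) ≤ 2 ^ (n + 1) := one_le_pow₀ (by norm_num)
    rw [hp]
    have h3 : Q 0 * (2 ^ (n + 1) * 2 - 1) = 0 := by linear_combination -this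
    exact (mul_eq_zero.mp h3).resolve_right (by linarith)
  · obtain ⟨θ, hθ⟩ := exists_sqrt_smul_cos_sin p
    have hr : 0 < √(p.1 ^ 2 + p.2 ^ 2) := by
      refine (Real.sqrt_nonneg _).lt_of_ne fun h0 => hp ?_
      rw [hθ, ← h0, zero_smul]
    rw [hθ, h.homogeneous _ _ hr, hcirc, smul_zero]

/-- A function with vanishing angular derivative on a disc is constant on circles. -/
theorem eq_of_angDeriv_eq_zero {f : ℝ × ℝ → ℝ} {R : ℝ}
    (hf : AnalyticOnNhd ℝ f {p : ℝ × ℝ | p.1 ^ 2 + p.2 ^ 2 < R ^ 2})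
    (h : ∀ p : ℝ × ℝ, p.1 ^ 2 + p.2 ^ 2 < R ^ 2 → angDeriv f p = 0) {p q : ℝ × ℝ}
    (hp : p.1 ^ 2 + p.2 ^ 2 < R ^ 2) (hpq : p.1 ^ 2 + p.2 ^ 2 = q.1 ^ 2 + q.2 ^ 2) :
    f p = f q := by
  obtain ⟨θ, hθ⟩ := exists_sqrt_smul_cos_sin p
  obtain ⟨φ, hφ⟩ := exists_sqrt_smul_cos_sin q
  rw [← hpq] at hφ
  set r := √(p.1 ^ 2 + p.2 ^ 2) with hr
  have hr2 : r ^ 2 = p.1 ^ 2 + p.2 ^ 2 := Real.sq_sqrt (by positivity)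
  have hmem : ∀ s : ℝ, (r * Real.cos s) ^ 2 + (r * Real.sin s) ^ 2 < R ^ 2 := fun s => by
    rw [mul_pow, mul_pow, ← mul_add, Real.cos_sq_add_sin_sq, mul_one, hr2]
    exact hp
  have hd : ∀ s, HasDerivAt (fun s => f (r * Real.cos s, r * Real.sin s)) 0 s := fun s => by
    refine (AnalyticAt.hasDerivAt_comp_curve (hf (r * Real.cos s, r * Real.sin s) (hmem s))
      ((Real.hasDerivAt_cos s).const_mul r) ((Real.hasDerivAt_sin s).const_mul r)).congr_deriv ?_
    have := h (r * Real.cos s, r * Real.sin s) (hmem s)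
    rw [angDeriv] at this
    linear_combination this
  rw [hθ, hφ]
  exact is_const_of_deriv_eq_zero (fun s => (hd s).differentiableAt) (fun s => (hd s).deriv) θ φ

/-- Adding an affine function and a multiple of `(x² + y²) / 2` does not change the Jacobian of the
Laplacian and the Hessian determinant. -/
theorem jacDet_lap_hessDet_add_quadratic {f g : ℝ × ℝ → ℝ} {s : Set (ℝ × ℝ)} (hs : IsOpen s)
    (hg : AnalyticOnNhd ℝ g s) {c a b l : ℝ}
    (hfg : ∀ p ∈ s, f p = c + a * p.1 + b * p.2 + l / 2 * (p.1 ^ 2 + p.2 ^ 2) + g p)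
    {p : ℝ × ℝ} (hp : p ∈ s) :
    jacDet (lap f) (hessDet f) p = jacDet (lap g) (hessDet g) p := by
  have hnear : ∀ {F G : ℝ × ℝ → ℝ}, (∀ q ∈ s, F q = G q) → ∀ q ∈ s, F =ᶠ[𝓝 q] G :=
    fun h q hq => Filter.eventually_of_mem (hs.mem_nhds hq) h
  have hx : ∀ q ∈ s, pdx f q = a + l * q.1 + pdx g q := fun q hq => by
    rw [pdx_congr (hnear hfg q hq)]
    refine ((((((hasDerivAt_id q.1).const_mul a).const_add c).add_const (b * q.2)).add
      (((hasDerivAt_pow 2 q.1).add_const (q.2 ^ 2)).const_mul (l / 2))).add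
      (hg q hq).hasDerivAt_pdx).deriv.trans ?_
    norm_num
    ring
  have hy : ∀ q ∈ s, pdy f q = b + l * q.2 + pdy g q := fun q hq => by
    rw [pdy_congr (hnear hfg q hq)]
    refine (((((hasDerivAt_id q.2).const_mul b).const_add (c + a * q.1)).add
      (((hasDerivAt_pow 2 q.2).const_add (q.1 ^ 2)).const_mul (l / 2))).add
      (hg q hq).hasDerivAt_pdy).deriv.trans ?_
    norm_num
    ring
  have hxx : ∀ q ∈ s, pdx (pdx f) q = l + pdx (pdx g) q := fun q hq => by
    rw [pdx_congr (hnear hx q hq)]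
    refine ((((hasDerivAt_id q.1).const_mul l).const_add a).add
      (hg q hq).partialX.hasDerivAt_pdx).deriv.trans ?_
    rw [mul_one]
  have hyy : ∀ q ∈ s, pdy (pdy f) q = l + pdy (pdy g) q := fun q hq => by
    rw [pdy_congr (hnear hy q hq)]
    refine ((((hasDerivAt_id q.2).const_mul l).const_add b).add
      (hg q hq).partialY.hasDerivAt_pdy).deriv.trans ?_
    rw [mul_one]
  have hxy : ∀ q ∈ s, pdx (pdy f) q = pdx (pdy g) q := fun q hq => by
    rw [pdx_congr (hnear hy q hq)]
    exact ((hg q hq).partialY.hasDerivAt_pdx.const_add (b + l * q.2)).deriv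
  have hlap : ∀ q ∈ s, lap f q = 2 * l + lap g q := fun q hq => by
    rw [lap, lap, hxx q hq, hyy q hq]
    ring
  have hdet : ∀ q ∈ s, hessDet f q = l ^ 2 + l * lap g q + hessDet g q := fun q hq => by
    rw [hessDet, hessDet, lap, hxx q hq, hyy q hq, hxy q hq]
    ring
  have hgl := (hg p hp).laplacian
  have hgd := (hg p hp).hessianDet
  have hlx : pdx (lap f) p = pdx (lap g) p :=
    (pdx_congr (hnear hlap p hp)).trans (hgl.hasDerivAt_pdx.const_add _).deriv
  have hly : pdy (lap f) p = pdy (lap g) p :=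
    (pdy_congr (hnear hlap p hp)).trans (hgl.hasDerivAt_pdy.const_add _).deriv
  have hdx : pdx (hessDet f) p = l * pdx (lap g) p + pdx (hessDet g) p :=
    (pdx_congr (hnear hdet p hp)).trans
      (((hgl.hasDerivAt_pdx.const_mul l).const_add _).add hgd.hasDerivAt_pdx).deriv
  have hdy : pdy (hessDet f) p = l * pdy (lap g) p + pdy (hessDet g) p :=
    (pdy_congr (hnear hdet p hp)).trans
      (((hgl.hasDerivAt_pdy.const_mul l).const_add _).add hgd.hasDerivAt_pdy).deriv
  rw [jacDet, jacDet, hlx, hly, hdx, hdy]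
  ring

/-- **Proposition 1.** Let `u` be real analytic on a ball `B` centered at the origin with
`J[Δu, det D²u] ≡ 0`, and write `u = c₀ + ax + by + (λ/2)(x²+y²) + u₁` where `u₁` vanishes
at the origin together with all derivatives up to order two. If the lowest-degree non-zero
homogeneous polynomial in the Taylor expansion of `u₁` at the origin is
`a₀ (x²+y²)^(k+1)` with `a₀ ≠ 0`, `k ≥ 1`, then `u₁` is radial with respect to the
origin on `B`. -/
theorem radial_symmetry_case_C3
    (R : ℝ) (hR : 0 < R)
    (u : ℝ × ℝ → ℝ)
    (hu : AnalyticOnNhd ℝ u {p : ℝ × ℝ | p.1 ^ 2 + p.2 ^ 2 < R ^ 2})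
    (hJ : ∀ p : ℝ × ℝ, p.1 ^ 2 + p.2 ^ 2 < R ^ 2 → jacDet (lap u) (hessDet u) p = 0)
    (c₀ a b l : ℝ) (u₁ : ℝ × ℝ → ℝ)
    (hrep : ∀ p : ℝ × ℝ, p.1 ^ 2 + p.2 ^ 2 < R ^ 2 →
      u p = c₀ + a * p.1 + b * p.2 + l / 2 * (p.1 ^ 2 + p.2 ^ 2) + u₁ p)
    -- `u₁` and all its derivatives up to order two vanish at the origin
    (h₀ : u₁ (0, 0) = 0) (h₁ : pdx u₁ (0, 0) = 0) (h₂ : pdy u₁ (0, 0) = 0)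
    (h₃ : pdx (pdx u₁) (0, 0) = 0) (h₄ : pdx (pdy u₁) (0, 0) = 0)
    (h₅ : pdy (pdx u₁) (0, 0) = 0) (h₆ : pdy (pdy u₁) (0, 0) = 0)
    -- the lowest-degree non-zero homogeneous Taylor term of `u₁` is `a₀ (x²+y²)^(k+1)`
    (k : ℕ) (hk : 1 ≤ k) (a₀ : ℝ) (ha₀ : a₀ ≠ 0)
    (ho : (fun p : ℝ × ℝ => u₁ p - a₀ * (p.1 ^ 2 + p.2 ^ 2) ^ (k + 1))
      =o[𝓝 ((0, 0) : ℝ × ℝ)] fun p => ‖p‖ ^ (2 * k + 2)) :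
    ∀ q₁ : ℝ × ℝ, q₁.1 ^ 2 + q₁.2 ^ 2 < R ^ 2 →
      ∀ q₂ : ℝ × ℝ, q₂.1 ^ 2 + q₂.2 ^ 2 < R ^ 2 →
        q₁.1 ^ 2 + q₁.2 ^ 2 = q₂.1 ^ 2 + q₂.2 ^ 2 → u₁ q₁ = u₁ q₂ := by
  set U : Set (ℝ × ℝ) := {p : ℝ × ℝ | p.1 ^ 2 + p.2 ^ 2 < R ^ 2} with hU
  have hopen : IsOpen U := isOpen_lt (by fun_prop) continuous_const
  have hzero : (0 : ℝ × ℝ) ∈ U := by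
    have : 0 < R ^ 2 := by positivity
    simpa [hU] using this
  have hpre : IsPreconnected U := by
    have hsq : ConvexOn ℝ univ fun x : ℝ => x ^ 2 := even_two.convexOn_pow
    have hconv : ConvexOn ℝ univ fun p : ℝ × ℝ => p.1 ^ 2 + p.2 ^ 2 :=
      (hsq.comp_linearMap (LinearMap.fst ℝ ℝ ℝ)).add (hsq.comp_linearMap (LinearMap.snd ℝ ℝ ℝ))
    have h := hconv.convex_lt (R ^ 2)
    simp only [mem_univ, true_and] at h
    exact h.isPreconnected
  have hu₁ : AnalyticOnNhd ℝ u₁ U := fun p hp => by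
    have hquad : AnalyticAt ℝ (fun p : ℝ × ℝ =>
        c₀ + a * p.1 + b * p.2 + l / 2 * (p.1 ^ 2 + p.2 ^ 2)) p :=
      ((analyticAt_const.add (analyticAt_const.mul analyticAt_fst)).add
        (analyticAt_const.mul analyticAt_snd)).add
        (analyticAt_const.mul ((analyticAt_fst.pow 2).add (analyticAt_snd.pow 2)))
    refine ((hu p hp).sub hquad).congr ?_
    filter_upwards [hopen.mem_nhds hp] with q hq
    simp only [Pi.sub_apply]
    rw [hrep q hq]
    ring
  obtain ⟨j, rfl⟩ := Nat.exists_eq_add_of_le' hk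
  have hlead : IsLeading (2 * j + 1 + 3) u₁ (radialPow a₀ (j + 2)) :=
    ⟨hu₁ 0 hzero, analyticAt_radialPow a₀ (j + 2), fun t p _ => radialPow_smul a₀ (j + 2) t p, ho⟩
  have hang : AnalyticOnNhd ℝ (angDeriv u₁) U := fun p hp => (hu₁ p hp).angular
  have hev : ∀ᶠ p in 𝓝 0, angDeriv u₁ p = 0 := by
    by_contra hne
    obtain ⟨m, Q, hQ, hQne⟩ := (hang 0 hzero).exists_isLeading hne
    have hm : 2 * j + 4 < m :=
      hQ.lt_of_isLittleO hQne (hlead.angDeriv_isLittleO (angDeriv_radialPow a₀ (j + 1)))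
    obtain ⟨n, rfl⟩ := Nat.exists_eq_add_of_le' (show 2 ≤ m by omega)
    obtain ⟨p, hp⟩ := hQne
    refine hp (hQ.eq_zero_of_radialPow ha₀ hm (hlead.eulerOp_mul_hessMixed hQ ?_) p)
    filter_upwards [hopen.mem_nhds hzero] with q hq
    rw [← (hu₁ q hq).jacDet_lap_hessDet,
      ← jacDet_lap_hessDet_add_quadratic hopen hu₁ hrep hq, hJ q hq, mul_zero]
  have hall := hang.eqOn_zero_of_preconnected_of_eventuallyEq_zero hpre hzero hev
  intro q₁ hq₁ q₂ _ hq
  exact eq_of_angDeriv_eq_zero hu₁ (fun p hp => hall hp) hq₁ hq
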